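/- arXiv:1202.1670 — 3 statements merged into one kernel-verified Lean document; each statement's English description precedes it below -/
import Mathlib

section
/- Let k ≥ 3 be an integer, let n be a positive integer, and let d be a squarefree positive integer with 1 ≤ d ≤ n. Then |B_{k,d}(n) − Ξ_{k,n}(d) · (n/d)^{k−1} / (k−1)!| ≤ Ξ_{k,n}(d) · (k − 1 + e^{2/3}·(3e/2)^{k−1}/√(2π(k−1))) · n^{k−2} · d. -/
/-- `δ_k(x) = ((x−1)^k + k(x−1)^{k−1} + (−1)^k(k−1))/x`. -/
noncomputable def delta (k : ℕ) (x : ℝ) : ℝ :=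
  ((x - 1) ^ k + (k : ℝ) * (x - 1) ^ (k - 1) + (-1 : ℝ) ^ k * ((k : ℝ) - 1)) / x

/-- `η_k(x) = ((x−1)^k + k(x−1)^{k−1} + (−1)^{k−1}(k−1)(x−1))/x`. -/
noncomputable def eta (k : ℕ) (x : ℝ) : ℝ :=
  ((x - 1) ^ k + (k : ℝ) * (x - 1) ^ (k - 1) + (-1 : ℝ) ^ (k - 1) * ((k : ℝ) - 1) * (x - 1)) / x

/-- `Ξ_{k,n}(d) = ∏_{p ∣ d, p ∣ n} η_k(p) · ∏_{p ∣ d, p ∤ n} δ_k(p)`. -/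
noncomputable def Xi (k n d : ℕ) : ℝ :=
  ∏ p ∈ d.primeFactors, (if p ∣ n then eta k (p : ℝ) else delta k (p : ℝ))

/-- `B_{k,d}(n)` is the number of `k`-tuples of positive integers summing to `n` such that no
prime divisor of `d` divides `gcd(x_i, x_j)` for distinct `i, j`. -/
noncomputable def Bd (k d n : ℕ) : ℕ :=
  Nat.card {v : Fin k → ℕ // (∀ i, 0 < v i) ∧ (∑ i, v i) = n ∧
    ∀ p : ℕ, p.Prime → p ∣ d → ∀ i j, i ≠ j → ¬ p ∣ Nat.gcd (v i) (v j)}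

/-- Splitting off the first coordinate in a sum over functions on `Fin (k + 1)`. -/
theorem sum_fin_succ_functions {α M : Type*} [Fintype α] [AddCommMonoid M] (k : ℕ)
    (F : (Fin (k + 1) → α) → M) :
    ∑ v, F v = ∑ x, ∑ w : Fin k → α, F (Fin.cons x w) := by
  rw [← Fintype.sum_prod_type']
  exact (Fintype.sum_equiv (Fin.consEquiv fun _ : Fin (k + 1) ↦ α) _ _ fun _ ↦ rfl).symm

/-- Indicator of the nowhere vanishing functions `Fin k → ZMod p` with sum `a`, summed up. -/
theorem mul_card_nonzero_sum_eq (p : ℕ) [NeZero p] (k : ℕ) (a : ZMod p) :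
    (p : ℝ) * ∑ w : Fin k → ZMod p, (if ∑ i, w i = a ∧ ∀ i, w i ≠ 0 then (1 : ℝ) else 0) =
      ((p : ℝ) - 1) ^ k + ((if a = 0 then (p : ℝ) else 0) - 1) * (-1) ^ k := by
  induction k generalizing a with
  | zero => simp [eq_comm]
  | succ k ih =>
    have hp : (p : ℝ) ≠ 0 := by exact_mod_cast NeZero.ne p
    set f : ZMod p → ℝ := fun a ↦
      ∑ w : Fin k → ZMod p, (if ∑ i, w i = a ∧ ∀ i, w i ≠ 0 then (1 : ℝ) else 0) with hf
    have htot : ∑ x, f (a - x) = ((p : ℝ) - 1) ^ k := by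
      have h1 : ∑ x, f (a - x) = ∑ x, f x := (Equiv.subLeft a).sum_comp f
      have h2 : (p : ℝ) * ∑ x, f x = p * ((p : ℝ) - 1) ^ k := by
        rw [Finset.mul_sum, Finset.sum_congr rfl fun x _ ↦ ih x, Finset.sum_add_distrib,
          ← Finset.sum_mul, Finset.sum_sub_distrib]
        simp [ZMod.card]
      rw [h1]; exact mul_left_cancel₀ hp h2
    have hrec : ∑ w : Fin (k + 1) → ZMod p,
        (if ∑ i, w i = a ∧ ∀ i, w i ≠ 0 then (1 : ℝ) else 0) = ∑ x, f (a - x) - f a := by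
      rw [sum_fin_succ_functions, ← Finset.add_sum_erase _ _ (Finset.mem_univ (0 : ZMod p)),
        ← Finset.add_sum_erase _ (fun x ↦ f (a - x)) (Finset.mem_univ (0 : ZMod p))]
      have h0 : ∀ x ∈ Finset.univ.erase (0 : ZMod p), ∑ w : Fin k → ZMod p,
          (if ∑ i, (Fin.cons x w : Fin (k + 1) → ZMod p) i = a ∧
            ∀ i, (Fin.cons x w : Fin (k + 1) → ZMod p) i ≠ 0 then (1 : ℝ) else 0) =
          f (a - x) := by
        intro x hx
        refine Finset.sum_congr rfl fun w _ ↦ ?_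
        simp [Fin.sum_univ_succ, Fin.forall_fin_succ, Finset.ne_of_mem_erase hx,
          eq_sub_iff_add_eq']
      rw [Finset.sum_congr rfl h0]
      simp [Fin.forall_fin_succ]
    rw [hrec, htot, mul_sub, ih a]
    ring

/-- Count of functions `Fin k → ZMod p` with sum `a` which vanish at most once. -/
theorem mul_card_atMostOneZero_sum_eq (p : ℕ) [NeZero p] (k : ℕ) (a : ZMod p) :
    (p : ℝ) * ∑ w : Fin k → ZMod p, (if ∑ i, w i = a ∧
        ∀ i j, i ≠ j → ¬ (w i = 0 ∧ w j = 0) then (1 : ℝ) else 0) =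
      ((p : ℝ) - 1) ^ k + k * ((p : ℝ) - 1) ^ (k - 1) +
        ((if a = 0 then (p : ℝ) else 0) - 1) * ((-1) ^ k + k * (-1) ^ (k - 1)) := by
  induction k generalizing a with
  | zero => simp [eq_comm]
  | succ k ih =>
    have hp : (p : ℝ) ≠ 0 := by exact_mod_cast NeZero.ne p
    set f : ZMod p → ℝ := fun a ↦ ∑ w : Fin k → ZMod p, (if ∑ i, w i = a ∧
        ∀ i j, i ≠ j → ¬ (w i = 0 ∧ w j = 0) then (1 : ℝ) else 0) with hf
    have htot : ∑ x, f (a - x) = ((p : ℝ) - 1) ^ k + k * ((p : ℝ) - 1) ^ (k - 1) := by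
      have h1 : ∑ x, f (a - x) = ∑ x, f x := (Equiv.subLeft a).sum_comp f
      have h2 : (p : ℝ) * ∑ x, f x =
          p * (((p : ℝ) - 1) ^ k + k * ((p : ℝ) - 1) ^ (k - 1)) := by
        rw [Finset.mul_sum, Finset.sum_congr rfl fun x _ ↦ ih x, Finset.sum_add_distrib,
          ← Finset.sum_mul, Finset.sum_sub_distrib]
        simp [ZMod.card]
        ring
      rw [h1]; exact mul_left_cancel₀ hp h2
    have hrec : ∑ w : Fin (k + 1) → ZMod p, (if ∑ i, w i = a ∧
          ∀ i j, i ≠ j → ¬ (w i = 0 ∧ w j = 0) then (1 : ℝ) else 0) =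
        (∑ w : Fin k → ZMod p, (if ∑ i, w i = a ∧ ∀ i, w i ≠ 0 then (1 : ℝ) else 0)) +
          (∑ x, f (a - x) - f a) := by
      rw [sum_fin_succ_functions, ← Finset.add_sum_erase _ _ (Finset.mem_univ (0 : ZMod p)),
        ← Finset.add_sum_erase _ (fun x ↦ f (a - x)) (Finset.mem_univ (0 : ZMod p))]
      have h0 : ∀ x ∈ Finset.univ.erase (0 : ZMod p), ∑ w : Fin k → ZMod p,
          (if ∑ i, (Fin.cons x w : Fin (k + 1) → ZMod p) i = a ∧ ∀ i j, i ≠ j →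
            ¬ ((Fin.cons x w : Fin (k + 1) → ZMod p) i = 0 ∧
              (Fin.cons x w : Fin (k + 1) → ZMod p) j = 0) then (1 : ℝ) else 0) =
          f (a - x) := by
        intro x hx
        refine Finset.sum_congr rfl fun w _ ↦ ?_
        simp [Fin.sum_univ_succ, Fin.forall_fin_succ, Finset.ne_of_mem_erase hx,
          eq_sub_iff_add_eq']
      rw [Finset.sum_congr rfl h0, sub_zero, add_sub_cancel_left]
      congr 1
      refine Finset.sum_congr rfl fun w _ ↦ if_congr ?_ rfl rfl
      simp only [Fin.sum_univ_succ, Fin.forall_fin_succ, Fin.cons_zero, Fin.cons_succ, zero_add]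
      refine and_congr_right fun _ ↦ ⟨fun h i hi ↦ ?_, fun h ↦ ?_⟩
      · exact h.1.2 i (Fin.succ_ne_zero i).symm ⟨trivial, hi⟩
      · simp [h]
    rw [hrec, htot, mul_add, mul_sub, ih a, mul_card_nonzero_sum_eq]
    cases k with
    | zero => simp
    | succ k => simp only [Nat.add_sub_cancel]; push_cast; ring

theorem mul_prod_add_le (K : ℕ) {t : ℝ} (ht : 1 ≤ t) :
    t * ∏ i ∈ Finset.range K, (t + 1 + i) ≤ t ^ K * (t + ((K + 1).factorial - 1)) := by
  induction K with
  | zero => simp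
  | succ K ih =>
    have hc : (1 : ℝ) ≤ (K + 1).factorial := by exact_mod_cast Nat.factorial_pos _
    rw [Nat.factorial_succ, Finset.prod_range_succ, ← mul_assoc]
    push_cast
    set c : ℝ := ((K + 1).factorial : ℝ)
    have hK : (0 : ℝ) ≤ K := K.cast_nonneg
    calc _ ≤ t ^ K * (t + (c - 1)) * (t + 1 + K) := by gcongr
      _ = t ^ K * ((t + (c - 1)) * (t + 1 + K)) := by ring
      _ ≤ t ^ K * (t * (t + (((K : ℝ) + 1 + 1) * c - 1))) := by
        refine mul_le_mul_of_nonneg_left ?_ (by positivity)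
        nlinarith [mul_nonneg (mul_nonneg (sub_nonneg.2 hc) (sub_nonneg.2 ht))
          (add_nonneg zero_le_one hK)]
      _ = _ := by ring

theorem le_mul_prod_sub (K : ℕ) {t : ℝ} (ht : K ≤ t) :
    t ^ K * (t - K * (K + 1) / 2) ≤ t * ∏ i ∈ Finset.range K, (t - (i + 1)) := by
  induction K with
  | zero => simp
  | succ K ih =>
    push_cast at ht ⊢
    have hK : (0 : ℝ) ≤ K := K.cast_nonneg
    have ht0 : 0 ≤ t := by linarith
    rw [Finset.prod_range_succ, ← mul_assoc]
    calc _ = t ^ K * (t * (t - (K + 1) * (K + 1 + 1) / 2)) := by ring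
      _ ≤ t ^ K * ((t - K * (K + 1) / 2) * (t - (K + 1))) := by
        refine mul_le_mul_of_nonneg_left ?_ (by positivity)
        nlinarith [mul_nonneg (mul_nonneg hK (add_nonneg hK zero_le_one))
          (add_nonneg hK zero_le_one)]
      _ = t ^ K * (t - K * (K + 1) / 2) * (t - (K + 1)) := by ring
      _ ≤ _ := mul_le_mul_of_nonneg_right (ih (by linarith)) (by linarith)

/-- `t ^ K / K!` is at most `(K + 1) t ^ (K - 1)` for small `t`. -/
theorem pow_div_factorial_le {K : ℕ} (hK : 1 ≤ K) {t : ℝ} (ht : 0 ≤ t) (htK : t ≤ K + 1) :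
    t ^ K / K.factorial ≤ (K + 1) * t ^ (K - 1) := by
  have hf : (1 : ℝ) ≤ K.factorial := by exact_mod_cast Nat.factorial_pos _
  calc t ^ K / K.factorial ≤ t ^ K := div_le_self (by positivity) hf
    _ = t * t ^ (K - 1) := by rw [← pow_succ', Nat.sub_add_cancel hK]
    _ ≤ _ := by gcongr

theorem abs_choose_sub_pow_div_factorial_le {K m : ℕ} (hK : 1 ≤ K) {t : ℝ} (ht : 1 ≤ t)
    (hm : (m : ℝ) ≤ t) (hm' : t ≤ m + (K + 1)) :
    |((m + K).choose K : ℝ) - t ^ K / K.factorial| ≤ (K + 1) * t ^ (K - 1) := by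
  have hf : (1 : ℝ) ≤ K.factorial := by exact_mod_cast Nat.factorial_pos _
  have hf0 : (0 : ℝ) < K.factorial := by linarith
  have hKr : (1 : ℝ) ≤ K := by exact_mod_cast hK
  have ht0 : 0 < t := by linarith
  have htK : t * t ^ (K - 1) = t ^ K := by rw [← pow_succ', Nat.sub_add_cancel hK]
  have hprod : (K.factorial : ℝ) * (m + K).choose K =
      ∏ i ∈ Finset.range K, ((m : ℝ) + 1 + i) := by
    have := Nat.ascFactorial_eq_factorial_mul_choose m K
    rw [Nat.ascFactorial_eq_prod_range] at this
    exact_mod_cast this.symm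
  have hpow : 0 < t ^ (K - 1) := by positivity
  rw [abs_le]
  constructor
  · rcases le_total t (K + 1) with h | h
    · have := pow_div_factorial_le hK ht0.le h
      have h0 : (0 : ℝ) ≤ (m + K).choose K := Nat.cast_nonneg _
      linarith
    · have h1 := le_mul_prod_sub K (t := t) (by linarith)
      have h2 : ∏ i ∈ Finset.range K, (t - (i + 1)) ≤
          ∏ i ∈ Finset.range K, ((m : ℝ) + 1 + i) := by
        rw [← Finset.prod_range_reflect (fun i : ℕ ↦ (m : ℝ) + 1 + i)]
        refine Finset.prod_le_prod (fun i hi ↦ ?_) fun i hi ↦ ?_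
        · have : (i : ℝ) + 1 ≤ K := by exact_mod_cast Finset.mem_range.1 hi
          linarith
        · have : i + 1 ≤ K := Finset.mem_range.1 hi
          rw [Nat.sub_sub, Nat.cast_sub (by omega)]
          push_cast
          linarith
      rw [← hprod] at h2
      have h3 : t ^ (K - 1) * (t - K * (K + 1) / 2) ≤ K.factorial * (m + K).choose K := by
        refine le_trans (le_of_mul_le_mul_left ?_ ht0) h2
        rw [← mul_assoc, htK]
        exact h1
      have h4 : (K : ℝ) ≤ K.factorial := by exact_mod_cast K.self_le_factorial
      rw [neg_le_sub_iff_le_add, div_le_iff₀ hf0, ← htK]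
      have h5 : t ^ (K - 1) * (K * (K + 1) / 2) ≤ t ^ (K - 1) * ((K + 1) * K.factorial) := by
        gcongr
        nlinarith
      linarith
  · have h1 := mul_prod_add_le K ht
    have h2 : ∏ i ∈ Finset.range K, ((m : ℝ) + 1 + i) ≤
        ∏ i ∈ Finset.range K, (t + 1 + i) := by
      gcongr
    rw [← hprod] at h2
    have h3 : K.factorial * ((m + K).choose K : ℝ) ≤
        t ^ (K - 1) * (t + ((K + 1).factorial - 1)) := by
      refine le_trans h2 (le_of_mul_le_mul_left ?_ ht0)
      rw [← mul_assoc, htK]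
      exact h1
    rw [sub_le_iff_le_add, ← mul_le_mul_iff_right₀ hf0, mul_add, mul_div_cancel₀ _ hf0.ne', ← htK]
    rw [Nat.factorial_succ] at h3
    push_cast at h3
    nlinarith

theorem card_residue_class_eq {k d n m : ℕ} (hd : 0 < d) {r : Fin k → ℕ}
    (hr0 : ∀ i, 0 < r i) (hrd : ∀ i, r i ≤ d) (hm : n = ∑ i, r i + d * m) :
    {v ∈ Finset.piAntidiag (Finset.univ : Finset (Fin k)) n |
      (∀ i, 0 < v i) ∧ ∀ i, v i ≡ r i [MOD d]}.card = (k + m - 1).choose m := by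
  have hcard := Finset.card_finsuppAntidiag_nat_eq_choose (s := (Finset.univ : Finset (Fin k))) m
  rw [Finset.card_univ, Fintype.card_fin] at hcard
  rw [← hcard]
  symm
  refine Finset.card_bij (fun f _ i ↦ r i + d * f i) ?_ ?_ ?_
  · intro f hf
    simp only [Finset.mem_finsuppAntidiag] at hf
    simp only [Finset.mem_filter, Finset.mem_piAntidiag, Finset.sum_add_distrib,
      ← Finset.mul_sum, hf.1, hm, Finset.mem_univ, implies_true, and_true, true_and]
    exact ⟨fun i ↦ Nat.add_pos_left (hr0 i) _, fun i ↦ by simp [Nat.ModEq]⟩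
  · intro f _ g _ h
    ext i
    have := congrFun h i
    simpa [hd.ne'] using this
  · intro v hv
    simp only [Finset.mem_filter, Finset.mem_piAntidiag, Finset.mem_univ, implies_true,
      and_true] at hv
    obtain ⟨hsum, hpos, hmod⟩ := hv
    have hex : ∀ i, ∃ y, v i = r i + d * y := fun i ↦ by
      have hle : r i ≤ v i := by
        by_contra! hlt
        have := (Nat.modEq_iff_dvd' hlt.le).1 (hmod i)
        have := Nat.le_of_dvd (by omega) this
        have := hrd i
        have := hpos i
        omega
      obtain ⟨y, hy⟩ := (Nat.modEq_iff_dvd' hle).1 (hmod i).symm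
      exact ⟨y, by omega⟩
    choose y hy using hex
    refine ⟨Finsupp.equivFunOnFinite.symm y, ?_, ?_⟩
    · simp only [Finset.mem_finsuppAntidiag, Finset.subset_univ, and_true,
        Finsupp.coe_equivFunOnFinite_symm]
      simp only [hy, Finset.sum_add_distrib, ← Finset.mul_sum, hm] at hsum
      exact Nat.eq_of_mul_eq_mul_left hd (Nat.add_left_cancel hsum)
    · ext i
      simp [hy]

/-- The number of positive solutions in a fixed residue class modulo `d`. -/
theorem abs_card_residue_class_sub_le {K d n : ℕ} (hK : 1 ≤ K) (hd : 0 < d) (hdn : d ≤ n)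
    {r : Fin (K + 1) → ℕ} (hr0 : ∀ i, 0 < r i) (hrd : ∀ i, r i ≤ d)
    (hr : ∑ i, r i ≡ n [MOD d]) :
    |(({v ∈ Finset.piAntidiag (Finset.univ : Finset (Fin (K + 1))) n |
        (∀ i, 0 < v i) ∧ ∀ i, v i ≡ r i [MOD d]}.card : ℕ) : ℝ) -
        ((n : ℝ) / d) ^ K / K.factorial| ≤ (K + 1) * ((n : ℝ) / d) ^ (K - 1) := by
  have hd' : (0 : ℝ) < d := by exact_mod_cast hd
  have ht : 1 ≤ (n : ℝ) / d := by
    rw [le_div_iff₀ hd', one_mul]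
    exact_mod_cast hdn
  have hsum : ∑ i, r i ≤ (K + 1) * d := by
    simpa using Finset.sum_le_sum fun i (_ : i ∈ Finset.univ) ↦ hrd i
  have hsum' : ((∑ i, r i : ℕ) : ℝ) ≤ (K + 1) * d := by exact_mod_cast hsum
  by_cases hle : ∑ i, r i ≤ n
  · obtain ⟨m, hm⟩ := (Nat.modEq_iff_dvd' hle).1 hr
    have hm : n = ∑ i, r i + d * m := by omega
    rw [card_residue_class_eq hd hr0 hrd hm, show K + 1 + m - 1 = m + K by omega,
      Nat.choose_symm_add]
    have hmr : (n : ℝ) = ((∑ i, r i : ℕ) : ℝ) + d * m := by exact_mod_cast hm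
    have h0 : (0 : ℝ) ≤ ((∑ i, r i : ℕ) : ℝ) := Nat.cast_nonneg _
    apply abs_choose_sub_pow_div_factorial_le hK ht
    · rw [le_div_iff₀ hd']
      linarith
    · rw [div_le_iff₀ hd']
      linarith
  · rw [Finset.filter_eq_empty_iff.2, Finset.card_empty, Nat.cast_zero, zero_sub, abs_neg,
      abs_of_nonneg (by positivity)]
    · apply pow_div_factorial_le hK (by linarith)
      rw [div_le_iff₀ hd']
      have : (n : ℝ) ≤ ((∑ i, r i : ℕ) : ℝ) := by exact_mod_cast (not_le.1 hle).le
      linarith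
    · rintro v hv ⟨hpos, hmod⟩
      rw [Finset.mem_piAntidiag] at hv
      refine hle (hv.1 ▸ Finset.sum_le_sum fun i _ ↦ ?_)
      by_contra! hlt
      have := Nat.le_of_dvd (by omega) ((Nat.modEq_iff_dvd' hlt.le).1 (hmod i))
      have := hrd i
      have := hpos i
      omega

/-- Tuples modulo `p` with sum `n` and at most one vanishing coordinate. -/
def admissibleTuples (k n p : ℕ) [NeZero p] : Finset (Fin k → ZMod p) :=
  {w | ∑ i, w i = n ∧ ∀ i j, i ≠ j → ¬ (w i = 0 ∧ w j = 0)}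

theorem card_admissibleTuples {k : ℕ} (hk : 1 ≤ k) (n p : ℕ) [NeZero p] :
    ((admissibleTuples k n p).card : ℝ) = if p ∣ n then eta k p else delta k p := by
  have hp : (p : ℝ) ≠ 0 := by exact_mod_cast NeZero.ne p
  have h := mul_card_atMostOneZero_sum_eq p k n
  rw [Finset.sum_boole] at h
  have hsign : (-1 : ℝ) ^ k = -(-1) ^ (k - 1) := by
    obtain ⟨j, rfl⟩ := Nat.exists_eq_add_of_le' hk
    simp [pow_succ]
  rw [admissibleTuples, ← mul_right_inj' hp, h]
  simp only [ZMod.natCast_eq_zero_iff]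
  split_ifs
  · rw [eta, mul_div_cancel₀ _ hp, hsign]
    ring
  · rw [delta, mul_div_cancel₀ _ hp, hsign]
    ring

theorem one_le_exp_mul_pow_div_sqrt {K : ℕ} (hK : 1 ≤ K) :
    1 ≤ Real.exp (2 / 3) * (3 * Real.exp 1 / 2) ^ K / Real.sqrt (2 * Real.pi * K) := by
  have hKr : (1 : ℝ) ≤ K := by exact_mod_cast hK
  have hpi := Real.pi_pos
  rw [le_div_iff₀ (Real.sqrt_pos.2 (by positivity)), one_mul]
  have he : (4 : ℝ) ≤ 3 * Real.exp 1 / 2 := by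
    have := Real.exp_one_gt_d9
    linarith
  calc Real.sqrt (2 * Real.pi * K) ≤ 4 ^ K := by
        rw [Real.sqrt_le_left (by positivity), ← pow_mul, mul_comm K, pow_mul]
        have := one_add_mul_le_pow (a := (15 : ℝ)) (by norm_num) K
        norm_num at this ⊢
        nlinarith [Real.pi_lt_four]
    _ ≤ (3 * Real.exp 1 / 2) ^ K := by gcongr
    _ ≤ _ := le_mul_of_one_le_left (by positivity) (Real.one_le_exp (by norm_num))

theorem abs_Bd_sub_le {K d n : ℕ} (hK : 1 ≤ K) (hd : Squarefree d) (hdn : d ≤ n) :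
    |(Bd (K + 1) d n : ℝ) - Xi (K + 1) n d * (((n : ℝ) / d) ^ K / K.factorial)| ≤
      Xi (K + 1) n d * ((K + 1) * ((n : ℝ) / d) ^ (K - 1)) := by
  classical
  have hd0 : 0 < d := Nat.pos_of_ne_zero hd.ne_zero
  have : ∀ p : d.primeFactors, NeZero p.1 :=
    fun p ↦ ⟨(Nat.prime_of_mem_primeFactors p.2).ne_zero⟩
  set P : Finset (∀ p : d.primeFactors, Fin (K + 1) → ZMod p) :=
    Fintype.piFinset fun p ↦ admissibleTuples (K + 1) n p with hP
  have hcardP : (P.card : ℝ) = Xi (K + 1) n d := by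
    rw [hP, Fintype.card_piFinset, Nat.cast_prod, Xi,
      ← Finset.prod_coe_sort d.primeFactors
        (fun p ↦ if p ∣ n then eta (K + 1) (p : ℝ) else delta (K + 1) p)]
    exact Finset.prod_congr rfl fun p _ ↦ card_admissibleTuples (by omega) n p
  set S : Finset (Fin (K + 1) → ℕ) := {v ∈ Finset.piAntidiag Finset.univ n |
    (∀ i, 0 < v i) ∧ ∀ p : ℕ, p.Prime → p ∣ d → ∀ i j, i ≠ j → ¬ p ∣ Nat.gcd (v i) (v j)}
    with hS
  have hB : Bd (K + 1) d n = S.card := by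
    rw [Bd, ← Nat.card_eq_finsetCard]
    exact Nat.card_congr (Equiv.subtypeEquivRight fun v ↦ by
      simp [hS, Finset.mem_piAntidiag, and_left_comm])
  set φ : (Fin (K + 1) → ℕ) → ∀ p : d.primeFactors, Fin (K + 1) → ZMod p :=
    fun v p i ↦ (v i : ZMod p) with hφ
  have hmaps : Set.MapsTo φ S P := by
    intro v hv
    simp only [hS, Finset.coe_filter, Finset.mem_piAntidiag, Set.mem_ofPred_eq] at hv
    simp only [hP, Finset.mem_coe, Fintype.mem_piFinset, admissibleTuples, Finset.mem_filter,
      Finset.mem_univ, true_and, hφ, ZMod.natCast_eq_zero_iff]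
    intro p
    refine ⟨by rw [← hv.1.1]; push_cast; rfl, fun i j hij h ↦ ?_⟩
    exact hv.2.2 p (Nat.prime_of_mem_primeFactors p.2) (Nat.dvd_of_mem_primeFactors p.2) i j hij
      (Nat.dvd_gcd h.1 h.2)
  have hdvd : ∀ a : ℤ, (∀ p ∈ d.primeFactors, (p : ℤ) ∣ a) → (d : ℤ) ∣ a := by
    intro a ha
    rw [Int.natCast_dvd, ← Nat.prod_primeFactors_of_squarefree hd]
    exact Finset.prod_primes_dvd _ (fun p hp ↦ (Nat.prime_of_mem_primeFactors hp).prime)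
      fun p hp ↦ Int.natCast_dvd.1 (ha p hp)
  have hclass : ∀ c ∈ P, |(({v ∈ S | φ v = c}.card : ℕ) : ℝ) -
      ((n : ℝ) / d) ^ K / K.factorial| ≤ (K + 1) * ((n : ℝ) / d) ^ (K - 1) := by
    intro c hc
    simp only [hP, Fintype.mem_piFinset, admissibleTuples, Finset.mem_filter,
      Finset.mem_univ, true_and] at hc
    have hex : ∀ i, ∃ r : ℕ, 0 < r ∧ r ≤ d ∧ ∀ p : d.primeFactors, (r : ZMod p) = c p i := by
      intro i
      obtain ⟨s, hs⟩ := Nat.chineseRemainderOfFinset (fun p : d.primeFactors ↦ (c p i).val)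
        (fun p ↦ p.1) Finset.univ (fun p _ ↦ NeZero.ne p.1) (fun p _ q _ hpq ↦
          (Nat.coprime_primes (Nat.prime_of_mem_primeFactors p.2)
            (Nat.prime_of_mem_primeFactors q.2)).2 fun h ↦ hpq (Subtype.ext h))
      have hs' : ∀ p : d.primeFactors, (s : ZMod p) = c p i := fun p ↦ by
        rw [(ZMod.natCast_eq_natCast_iff _ _ _).2 (hs p (Finset.mem_univ _)),
          ZMod.natCast_zmod_val]
      have hd_zero : ∀ p : d.primeFactors, (d : ZMod p) = 0 := fun p ↦
        (ZMod.natCast_eq_zero_iff _ _).2 (Nat.dvd_of_mem_primeFactors p.2)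
      rcases Nat.eq_zero_or_pos (s % d) with h | h
      · refine ⟨d, hd0, le_rfl, fun p ↦ ?_⟩
        obtain ⟨q, rfl⟩ := Nat.dvd_of_mod_eq_zero h
        rw [← hs' p]
        simp [hd_zero]
      · refine ⟨s % d, h, (Nat.mod_lt _ hd0).le, fun p ↦ ?_⟩
        rw [← hs' p]
        conv_rhs => rw [← Nat.mod_add_div s d]
        simp [hd_zero]
    choose r hr0 hrd hrc using hex
    have hiff : ∀ a b : ℕ, (∀ p : d.primeFactors, (a : ZMod p) = b) ↔ a ≡ b [MOD d] := by
      intro a b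
      constructor
      · intro h
        rw [Nat.modEq_iff_dvd]
        refine hdvd _ fun p hp ↦ ?_
        rw [← Nat.modEq_iff_dvd, ← ZMod.natCast_eq_natCast_iff]
        exact h ⟨p, hp⟩
      · intro h p
        rw [ZMod.natCast_eq_natCast_iff]
        exact h.of_dvd (Nat.dvd_of_mem_primeFactors p.2)
    have hsum : ∑ i, r i ≡ n [MOD d] := by
      rw [← hiff]
      intro p
      push_cast
      simp only [hrc, (hc p).1]
    have hSc : {v ∈ S | φ v = c} =
        {v ∈ Finset.piAntidiag (Finset.univ : Finset (Fin (K + 1))) n |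
        (∀ i, 0 < v i) ∧ ∀ i, v i ≡ r i [MOD d]} := by
      ext v
      have hcv : φ v = c ↔ ∀ i, v i ≡ r i [MOD d] := by
        simp only [← hiff, hrc, hφ, funext_iff]
        exact forall_comm
      simp only [hS, Finset.mem_filter, and_assoc, hcv]
      refine and_congr_right fun _ ↦ and_congr_right fun _ ↦ and_iff_right_of_imp ?_
      intro hv p hp hpd i j hij hgcd
      have hpc := (hc ⟨p, Nat.mem_primeFactors.2 ⟨hp, hpd, hd0.ne'⟩⟩).2 i j hij
      rw [← hcv.2 hv] at hpc
      simp only [hφ, ZMod.natCast_eq_zero_iff] at hpc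
      exact hpc ⟨hgcd.trans (Nat.gcd_dvd_left _ _), hgcd.trans (Nat.gcd_dvd_right _ _)⟩
    rw [hSc]
    exact abs_card_residue_class_sub_le hK hd0 hdn hr0 hrd hsum
  rw [hB, ← hcardP, Finset.card_eq_sum_card_fiberwise hmaps, Nat.cast_sum, ← nsmul_eq_mul,
    ← Finset.sum_const, ← Finset.sum_sub_distrib, ← nsmul_eq_mul, ← Finset.sum_const]
  exact (Finset.abs_sum_le_sum_abs _ _).trans (Finset.sum_le_sum hclass)

theorem statement16 (k n d : ℕ) (hk : 3 ≤ k) (hn : 0 < n) (hd : Squarefree d)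
    (hd1 : 1 ≤ d) (hdn : d ≤ n) :
    |(Bd k d n : ℝ) -
        Xi k n d * ((n : ℝ) / (d : ℝ)) ^ (k - 1) / (Nat.factorial (k - 1) : ℝ)| ≤
      Xi k n d *
        ((k : ℝ) - 1 + Real.exp (2 / 3) * (3 * Real.exp 1 / 2) ^ (k - 1) /
          Real.sqrt (2 * Real.pi * ((k : ℝ) - 1))) * (n : ℝ) ^ (k - 2) * (d : ℝ) := by
  obtain ⟨K, rfl⟩ : ∃ K, k = K + 1 := ⟨k - 1, by omega⟩
  have hK : 1 ≤ K := by omega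
  have hXi : 0 ≤ Xi (K + 1) n d := Finset.prod_nonneg fun p hp ↦ by
    have : NeZero p := ⟨(Nat.prime_of_mem_primeFactors hp).ne_zero⟩
    rw [← card_admissibleTuples (by omega) n p]
    exact Nat.cast_nonneg _
  have hd' : (1 : ℝ) ≤ d := by exact_mod_cast hd1
  rw [Nat.add_sub_cancel, show K + 1 - 2 = K - 1 by omega, Nat.cast_add_one, add_sub_cancel_right,
    mul_div_assoc, mul_assoc, mul_assoc]
  refine (abs_Bd_sub_le hK hd hdn).trans (mul_le_mul_of_nonneg_left ?_ hXi)
  have hconst := one_le_exp_mul_pow_div_sqrt hK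
  gcongr
  calc ((n : ℝ) / d) ^ (K - 1) ≤ (n : ℝ) ^ (K - 1) := by
        gcongr
        exact div_le_self (Nat.cast_nonneg _) hd'
    _ ≤ _ := le_mul_of_one_le_right (by positivity) hd'
end

section
/- For every integer k ≥ 1 and every real number x ≥ 4, the sum Ω_k(x) = Σ_{d squarefree, 1 ≤ d ≤ x} k^{ω(d)}/d satisfies Ω_k(x) ≤ (e·log x)^k, where ω(d) denotes the number of distinct prime divisors of d. -/
/-- The number of factorizations of a squarefree `d` into `k` ordered factors is `k ^ ω(d)`. -/
theorem pow_card_primeFactors_div_eq_sum_finMulAntidiag (k : ℕ) {d : ℕ} (hd : Squarefree d) :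
    (k : ℝ) ^ d.primeFactors.card / (d : ℝ) =
      ∑ f ∈ Nat.finMulAntidiag k d, ∏ i, ((f i : ℕ) : ℝ)⁻¹ := by
  have hcard : (Nat.finMulAntidiag k d).card = k ^ d.primeFactors.card := by
    rw [Nat.card_finMulAntidiag_of_squarefree hd, ArithmeticFunction.cardDistinctFactors_apply,
      ← List.card_toFinset, Nat.toFinset_factors]
  have hprod : ∀ f ∈ Nat.finMulAntidiag k d, ∏ i, ((f i : ℕ) : ℝ)⁻¹ = (d : ℝ)⁻¹ := fun f hf => by
    rw [Finset.prod_inv_distrib, ← Nat.cast_prod, Nat.prod_eq_of_mem_finMulAntidiag hf]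
  rw [Finset.sum_congr rfl hprod, Finset.sum_const, hcard, nsmul_eq_mul, Nat.cast_pow,
    div_eq_mul_inv]

theorem sum_squarefree_pow_card_primeFactors_div_le_harmonic_pow (k n : ℕ) :
    ∑ d ∈ (Finset.Icc 1 n).filter (fun d => Squarefree d),
        (k : ℝ) ^ d.primeFactors.card / (d : ℝ) ≤ (harmonic n : ℝ) ^ k := by
  have hdisj : (((Finset.Icc 1 n).filter (fun d => Squarefree d) : Finset ℕ) :
      Set ℕ).PairwiseDisjoint (Nat.finMulAntidiag k) := fun a _ b _ hab =>
    Finset.disjoint_left.2 fun f hfa hfb => hab <|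
      (Nat.prod_eq_of_mem_finMulAntidiag hfa).symm.trans (Nat.prod_eq_of_mem_finMulAntidiag hfb)
  have hharm : (harmonic n : ℝ) = ∑ i ∈ Finset.Icc 1 n, (i : ℝ)⁻¹ := by
    rw [harmonic_eq_sum_Icc]
    push_cast
    rfl
  rw [Finset.sum_congr rfl fun d hd =>
      pow_card_primeFactors_div_eq_sum_finMulAntidiag k (Finset.mem_filter.1 hd).2,
    ← Finset.sum_biUnion hdisj, hharm, Finset.sum_pow']
  refine Finset.sum_le_sum_of_subset_of_nonneg (fun f hf => ?_) fun f _ _ => by positivity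
  obtain ⟨d, hd, hfd⟩ := Finset.mem_biUnion.1 hf
  have hd' := Finset.mem_Icc.1 (Finset.mem_filter.1 hd).1
  exact Fintype.mem_piFinset.2 fun i => Finset.mem_Icc.2
    ⟨Nat.one_le_iff_ne_zero.2 (Nat.ne_zero_of_mem_finMulAntidiag hfd i),
      (Nat.le_of_dvd hd'.1 (Nat.dvd_of_mem_finMulAntidiag hfd i)).trans hd'.2⟩

theorem statement18 (k : ℕ) (hk : 1 ≤ k) (x : ℝ) (hx : 4 ≤ x) :
    ∑ d ∈ (Finset.Icc 1 ⌊x⌋₊).filter (fun d => Squarefree d),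
        (k : ℝ) ^ d.primeFactors.card / (d : ℝ) ≤
      (Real.exp 1 * Real.log x) ^ k := by
  refine (sum_squarefree_pow_card_primeFactors_div_le_harmonic_pow k ⌊x⌋₊).trans ?_
  have hlog : 1 ≤ Real.log x :=
    (Real.le_log_iff_exp_le (by linarith)).2 (by linarith [Real.exp_one_lt_d9])
  have hbound := harmonic_floor_le_one_add_log x (by linarith)
  have hnonneg : (0 : ℝ) ≤ (harmonic ⌊x⌋₊ : ℝ) := by
    rw [harmonic]
    positivity
  refine pow_le_pow_left₀ hnonneg (hbound.trans ?_) k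
  nlinarith [Real.exp_one_gt_d9]
end

section
/- For every integer k ≥ 2 and every positive integer n, the series Σ_d μ(d)·Θ_{k,n}(d)/d^k, taken over all squarefree positive integers d (where μ is the Möbius function), converges absolutely and its sum equals C_k · f_k(n). -/
/-- `ψ_k(x) = (x^k − (x−1)^k + (−1)^k)/x`. -/
noncomputable def psi (k : ℕ) (x : ℝ) : ℝ := (x ^ k - (x - 1) ^ k + (-1 : ℝ) ^ k) / x

/-- `φ_k(x) = (x^k − (x−1)^k + (−1)^{k+1}(x−1))/x`. -/
noncomputable def phi (k : ℕ) (x : ℝ) : ℝ :=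
  (x ^ k - (x - 1) ^ k + (-1 : ℝ) ^ (k + 1) * (x - 1)) / x

/-- `Θ_{k,n}(d) = ∏_{p ∣ d, p ∣ n} φ_k(p) · ∏_{p ∣ d, p ∤ n} ψ_k(p)`. -/
noncomputable def Theta (k n d : ℕ) : ℝ :=
  ∏ p ∈ d.primeFactors, (if p ∣ n then phi k (p : ℝ) else psi k (p : ℝ))

/-- `C_k = ∏_p (1 − ψ_k(p)/p^k)` over all primes `p`. -/
noncomputable def C (k : ℕ) : ℝ := ∏' p : Nat.Primes, (1 - psi k (p : ℕ) / ((p : ℕ) : ℝ) ^ k)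

/-- `f_k(n) = ∏_{p ∣ n} (1 + (−1)^k/(p^k − ψ_k(p)))` over the distinct prime divisors of `n`. -/
noncomputable def f (k n : ℕ) : ℝ :=
  ∏ p ∈ n.primeFactors, (1 + (-1 : ℝ) ^ k / ((p : ℝ) ^ k - psi k (p : ℝ)))

theorem phi_eq_psi_sub (k : ℕ) {x : ℝ} (hx : x ≠ 0) : phi k x = psi k x - (-1) ^ k := by
  unfold phi psi
  field_simp
  ring

theorem psi_lt_pow (k : ℕ) {x : ℝ} (hx : 2 ≤ x) : psi k x < x ^ k := by
  have h1 : 1 ≤ (x - 1) ^ k := one_le_pow₀ (by linarith)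
  have h2 : (-1 : ℝ) ^ k ≤ 1 := (le_abs_self _).trans (by simp)
  have h3 : 0 < x ^ k := by positivity
  rw [psi, div_lt_iff₀ (by linarith)]
  nlinarith

theorem abs_pow_sub_pow_add_div_le {k : ℕ} (hk : 2 ≤ k) {x y : ℝ} (hx : 1 ≤ x) (hy : |y| ≤ x) :
    |(x ^ k - (x - 1) ^ k + y) / x / x ^ k| ≤ (k + 1) / x ^ 2 := by
  have hx0 : 0 < x := by linarith
  have h1 : |x ^ k - (x - 1) ^ k| ≤ k * x ^ (k - 1) := by
    refine (abs_pow_sub_pow_le (a := x) (b := x - 1) (n := k)).trans_eq ?_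
    rw [abs_of_pos hx0, abs_of_nonneg (by linarith : 0 ≤ x - 1), max_eq_left (by linarith)]
    simp
  have h2 : x ≤ x ^ (k - 1) := le_self_pow₀ hx (by omega)
  have h3 : |x ^ k - (x - 1) ^ k + y| ≤ (k + 1) * x ^ (k - 1) :=
    (abs_add_le _ _).trans (by linarith)
  rw [div_div, abs_div, abs_of_pos (by positivity : 0 < x * x ^ k),
    div_le_div_iff₀ (by positivity) (by positivity)]
  calc _ ≤ (k + 1) * x ^ (k - 1) * x ^ 2 := by gcongr
    _ = (k + 1) * (x * x ^ k) := by
      obtain ⟨m, rfl⟩ := Nat.exists_eq_add_of_le hk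
      rw [show 2 + m - 1 = m + 1 by omega]
      ring

theorem abs_psi_div_pow_le {k : ℕ} (hk : 2 ≤ k) {x : ℝ} (hx : 1 ≤ x) :
    |psi k x / x ^ k| ≤ (k + 1) / x ^ 2 :=
  abs_pow_sub_pow_add_div_le hk hx (by simpa using hx)

theorem abs_phi_div_pow_le {k : ℕ} (hk : 2 ≤ k) {x : ℝ} (hx : 1 ≤ x) :
    |phi k x / x ^ k| ≤ (k + 1) / x ^ 2 :=
  abs_pow_sub_pow_add_div_le hk hx (by
    rw [abs_mul, abs_pow, abs_neg, abs_one, one_pow, one_mul, abs_of_nonneg] <;> linarith)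

theorem one_sub_phi_div_pow (k : ℕ) {x : ℝ} (hx : 2 ≤ x) :
    1 - phi k x / x ^ k = (1 - psi k x / x ^ k) * (1 + (-1) ^ k / (x ^ k - psi k x)) := by
  have h1 : x ^ k - psi k x ≠ 0 := (sub_pos.2 (psi_lt_pow k hx)).ne'
  have h2 : x ^ k ≠ 0 := by positivity
  rw [phi_eq_psi_sub k (by linarith)]
  field_simp
  ring

theorem summable_abs_of_abs_le_div_sq {g : Nat.Primes → ℝ} {c : ℝ}
    (hg : ∀ p : Nat.Primes, |g p| ≤ c / ((p : ℕ) : ℝ) ^ 2) : Summable fun p => |g p| := by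
  have h : Summable fun m : ℕ => c / (m : ℝ) ^ 2 := by
    simpa [div_eq_mul_inv] using (Real.summable_nat_pow_inv.2 one_lt_two).mul_left c
  exact .of_nonneg_of_le (fun _ => abs_nonneg _) hg (h.comp_injective Subtype.val_injective)

/-- The prime divisors of a natural number, as elements of `Nat.Primes`. -/
def primeDivisors (n : ℕ) : Finset Nat.Primes := n.primeFactors.subtype Nat.Prime

theorem mem_primeDivisors {n : ℕ} {p : Nat.Primes} :
    p ∈ primeDivisors n ↔ (p : ℕ) ∈ n.primeFactors :=
  Finset.mem_subtype

theorem prod_primeDivisors {M : Type*} [CommMonoid M] (g : ℕ → M) (n : ℕ) :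
    ∏ p ∈ primeDivisors n, g p = ∏ p ∈ n.primeFactors, g p :=
  Finset.prod_subtype_of_mem g fun _ hp => Nat.prime_of_mem_primeFactors hp

/-- A squarefree natural number corresponds to its finite set of prime divisors. -/
noncomputable def squarefreeEquivFinsetPrimes : {d : ℕ // Squarefree d} ≃ Finset Nat.Primes where
  toFun d := primeDivisors d.1
  invFun s := ⟨∏ p ∈ s, (p : ℕ), Finset.squarefree_prod_of_pairwise_isCoprime
    (fun p _ q _ hpq => Nat.coprime_iff_isRelPrime.1 <|
      (Nat.coprime_primes p.2 q.2).2 fun h => hpq (Subtype.ext h))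
    fun p _ => p.2.prime.irreducible.squarefree⟩
  left_inv d := Subtype.ext <| by
    simpa only [prod_primeDivisors fun p => p] using Nat.prod_primeFactors_of_squarefree d.2
  right_inv s := by
    ext p
    rw [mem_primeDivisors, Nat.mem_primeFactors]
    constructor
    · rintro ⟨-, hp, -⟩
      obtain ⟨q, hq, hpq⟩ := (p.2.prime.dvd_finsetProd_iff _).1 hp
      rwa [Subtype.ext ((Nat.prime_dvd_prime_iff_eq p.2 q.2).1 hpq)]
    · exact fun hp => ⟨p.2, Finset.dvd_prod_of_mem _ hp,
        Finset.prod_ne_zero_iff.2 fun q _ => q.2.ne_zero⟩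

theorem moebius_mul_Theta_div_pow (k n : ℕ) {d : ℕ} (hd : Squarefree d) :
    (ArithmeticFunction.moebius d : ℝ) * Theta k n d / (d : ℝ) ^ k =
      ∏ p ∈ d.primeFactors,
        -((if p ∣ n then phi k (p : ℝ) else psi k (p : ℝ)) / (p : ℝ) ^ k) := by
  have h1 : (ArithmeticFunction.moebius d : ℝ) = (-1) ^ d.primeFactors.card := by
    rw [ArithmeticFunction.moebius_apply_of_squarefree hd,
      ← (ArithmeticFunction.cardDistinctFactors_eq_cardFactors_iff_squarefree hd.ne_zero).2 hd,
      ArithmeticFunction.cardDistinctFactors_apply, ← List.card_toFinset]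
    simp
  have h2 : (d : ℝ) = ∏ p ∈ d.primeFactors, (p : ℝ) := by
    rw [← Nat.cast_prod, Nat.prod_primeFactors_of_squarefree hd]
  rw [Finset.prod_neg, Finset.prod_div_distrib, Finset.prod_pow, ← h1, ← h2, Theta, mul_div_assoc]

theorem hasProd_f (k : ℕ) {n : ℕ} (hn : n ≠ 0) :
    HasProd (fun p : Nat.Primes => if (p : ℕ) ∣ n then
      1 + (-1 : ℝ) ^ k / (((p : ℕ) : ℝ) ^ k - psi k (p : ℕ)) else 1) (f k n) := by
  have h : f k n = ∏ p ∈ primeDivisors n, if (p : ℕ) ∣ n then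
      1 + (-1 : ℝ) ^ k / (((p : ℕ) : ℝ) ^ k - psi k (p : ℕ)) else 1 := by
    rw [prod_primeDivisors fun p : ℕ => if p ∣ n then
      1 + (-1 : ℝ) ^ k / ((p : ℝ) ^ k - psi k p) else 1]
    exact Finset.prod_congr rfl fun p hp => (if_pos (Nat.dvd_of_mem_primeFactors hp)).symm
  rw [h]
  exact hasProd_prod_of_ne_finset_one fun p hp => if_neg fun hpn =>
    hp (mem_primeDivisors.2 (Nat.mem_primeFactors.2 ⟨p.2, hpn, hn⟩))

theorem hasProd_C {k : ℕ} (hk : 2 ≤ k) :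
    HasProd (fun p : Nat.Primes => 1 - psi k (p : ℕ) / ((p : ℕ) : ℝ) ^ k) (C k) := by
  simp only [sub_eq_add_neg, C]
  refine (multipliable_one_add_of_summable ?_).hasProd
  simp only [norm_neg, Real.norm_eq_abs]
  exact summable_abs_of_abs_le_div_sq fun p => abs_psi_div_pow_le hk (mod_cast p.2.one_le)

theorem statement19 (k n : ℕ) (hk : 2 ≤ k) (hn : 0 < n) :
    Summable (fun d : {d : ℕ // Squarefree d} =>
      |(ArithmeticFunction.moebius d.1 : ℝ) * Theta k n d.1 / (d.1 : ℝ) ^ k|) ∧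
    ∑' d : {d : ℕ // Squarefree d},
        (ArithmeticFunction.moebius d.1 : ℝ) * Theta k n d.1 / (d.1 : ℝ) ^ k =
      C k * f k n := by
  set g : ℕ → ℝ := fun p =>
    -((if p ∣ n then phi k (p : ℝ) else psi k (p : ℝ)) / (p : ℝ) ^ k) with hg
  have hterm (d : {d : ℕ // Squarefree d}) :
      (ArithmeticFunction.moebius d.1 : ℝ) * Theta k n d.1 / (d.1 : ℝ) ^ k =
        ∏ p ∈ squarefreeEquivFinsetPrimes d, g p :=
    (moebius_mul_Theta_div_pow k n d.2).trans (prod_primeDivisors g d.1).symm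
  have hsum : Summable fun p : Nat.Primes => |g p| := by
    refine summable_abs_of_abs_le_div_sq (c := k + 1) fun p => ?_
    have hp : (1 : ℝ) ≤ (p : ℕ) := mod_cast p.2.one_le
    simp only [hg, abs_neg]
    split_ifs
    · exact abs_phi_div_pow_le hk hp
    · exact abs_psi_div_pow_le hk hp
  have hprod : HasProd (fun p : Nat.Primes => 1 + g p) (C k * f k n) := by
    refine ((hasProd_C hk).mul (hasProd_f k hn.ne')).congr_fun fun p => ?_
    by_cases hpn : (p : ℕ) ∣ n
    · simp only [hg, if_pos hpn, ← sub_eq_add_neg]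
      exact one_sub_phi_div_pow k (mod_cast p.2.two_le)
    · simp only [hg, if_neg hpn, ← sub_eq_add_neg, mul_one]
  simp only [hterm]
  constructor
  · simp only [Finset.abs_prod]
    exact (summable_finsetProd_of_summable_nonneg (fun _ => abs_nonneg _) hsum).comp_injective
      squarefreeEquivFinsetPrimes.injective
  · rw [squarefreeEquivFinsetPrimes.tsum_eq (fun s => ∏ p ∈ s, g p),
      ← tprod_one_add (summable_finsetProd_of_summable_norm
        (f := fun p : Nat.Primes => g p) hsum), hprod.tprod_eq]
end
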